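/- Given a natural number n > 0, every subtle cardinal is a stationary limit of strongly inaccessible C^(n)-weakly shrewd cardinals; that is, for every subtle cardinal δ, the set of strongly inaccessible C^(n)-weakly shrewd cardinals below δ intersects every closed unbounded subset of δ. -/

import Mathlib

namespace Paper

/-- First-order formulas in the language of set theory (one binary relation, membership),
using de Bruijn variables; `all` binds the last variable. -/
inductive SetFormula : ℕ → Type
  | mem {n : ℕ} (i j : Fin n) : SetFormula n
  | eq {n : ℕ} (i j : Fin n) : SetFormula n
  | fal {n : ℕ} : SetFormula n
  | imp {n : ℕ} (φ ψ : SetFormula n) : SetFormula n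
  | all {n : ℕ} (φ : SetFormula (n + 1)) : SetFormula n

namespace SetFormula

/-- Negation. -/
def not {n : ℕ} (φ : SetFormula n) : SetFormula n := φ.imp .fal

/-- Conjunction. -/
def and {n : ℕ} (φ ψ : SetFormula n) : SetFormula n := (φ.imp ψ.not).not

/-- Existential quantification (over the last variable). -/
def ex {n : ℕ} (φ : SetFormula (n + 1)) : SetFormula n := (SetFormula.all φ.not).not

end SetFormula

/-- Satisfaction of a set-theoretic formula in a structure `(M, E)`, where `E` interprets
the membership relation. -/
def Realize {M : Type*} (E : M → M → Prop) : ∀ {n : ℕ}, SetFormula n → (Fin n → M) → Prop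
  | _, .mem i j, v => E (v i) (v j)
  | _, .eq i j, v => v i = v j
  | _, .fal, _ => False
  | _, .imp φ ψ, v => Realize E φ v → Realize E ψ v
  | _, .all φ, v => ∀ a, Realize E φ (Fin.snoc v a)

/-- Satisfaction of a formula relativized to the subclass `S` of `M`; all quantifiers
range over `S`, and the assignment is required to take values in `S`. -/
def RealizeIn {M : Type*} (E : M → M → Prop) (S : M → Prop) {n : ℕ}
    (φ : SetFormula n) (v : Fin n → M) : Prop :=
  ∃ h : ∀ i, S (v i),
    Realize (fun a b : {x : M // S x} => E a.1 b.1) φ fun i => ⟨v i, h i⟩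

/-- `Δ₀`-formulas: formulas all of whose quantifiers are bounded. -/
inductive IsDelta0 : ∀ {n : ℕ}, SetFormula n → Prop
  | mem {n : ℕ} (i j : Fin n) : IsDelta0 (.mem i j)
  | eq {n : ℕ} (i j : Fin n) : IsDelta0 (.eq i j)
  | fal {n : ℕ} : IsDelta0 (n := n) .fal
  | imp {n : ℕ} {φ ψ : SetFormula n} : IsDelta0 φ → IsDelta0 ψ → IsDelta0 (φ.imp ψ)
  | ball {n : ℕ} (j : Fin n) {φ : SetFormula (n + 1)} :
      IsDelta0 φ → IsDelta0 (.all ((SetFormula.mem (Fin.last n) j.castSucc).imp φ))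
  | bex {n : ℕ} (j : Fin n) {φ : SetFormula (n + 1)} :
      IsDelta0 φ → IsDelta0 (SetFormula.ex ((SetFormula.mem (Fin.last n) j.castSucc).and φ))

mutual
  /-- `Σₙ`-formulas of the Lévy hierarchy. -/
  inductive IsSigma : ℕ → ∀ {n : ℕ}, SetFormula n → Prop
    | ofDelta0 {k n : ℕ} {φ : SetFormula n} : IsDelta0 φ → IsSigma k φ
    | ofPi {k n : ℕ} {φ : SetFormula n} : IsPi k φ → IsSigma (k + 1) φ
    | ex {k n : ℕ} {φ : SetFormula (n + 1)} : IsSigma (k + 1) φ → IsSigma (k + 1) φ.ex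
  /-- `Πₙ`-formulas of the Lévy hierarchy. -/
  inductive IsPi : ℕ → ∀ {n : ℕ}, SetFormula n → Prop
    | ofDelta0 {k n : ℕ} {φ : SetFormula n} : IsDelta0 φ → IsPi k φ
    | ofSigma {k n : ℕ} {φ : SetFormula n} : IsSigma k φ → IsPi (k + 1) φ
    | all {k n : ℕ} {φ : SetFormula (n + 1)} : IsPi (k + 1) φ → IsPi (k + 1) φ.all
end

end Paper
namespace Paper

section Generic

variable {M : Type*} (E : M → M → Prop)

/-- `x` is a transitive set (relative to the membership relation `E`). -/
def TransE (x : M) : Prop := ∀ y, E y x → ∀ z, E z y → E z x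

/-- `x` is an ordinal: a transitive set all of whose elements are transitive. -/
def OrdE (x : M) : Prop := TransE E x ∧ ∀ y, E y x → TransE E y

/-- `a ⊆ b`. -/
def SubE (a b : M) : Prop := ∀ z, E z a → E z b

/-- `a ≤ b` for ordinals. -/
def LeE (a b : M) : Prop := E a b ∨ a = b

/-- `x` is the empty set. -/
def EmptyE (x : M) : Prop := ∀ z, ¬ E z x

/-- `s = y ∪ {y}`. -/
def SuccSpecE (s y : M) : Prop := ∀ z, E z s ↔ (E z y ∨ z = y)

/-- `l` is a (nonzero) limit ordinal. -/
def LimitE (l : M) : Prop := OrdE E l ∧ (∃ w, E w l) ∧ ∀ α, E α l → ∃ β, E β l ∧ E α β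

/-- `w` is the first infinite ordinal `ω`. -/
def OmegaSpecE (w : M) : Prop := LimitE E w ∧ ∀ x, E x w → ¬ LimitE E x

/-- `x` is an infinite ordinal, i.e. an ordinal with `ω ≤ x`. -/
def InfiniteOrdE (x : M) : Prop := OrdE E x ∧ ∃ w, OmegaSpecE E w ∧ LeE E w x

/-- `p = {a, b}`. -/
def UPairE (p a b : M) : Prop := ∀ z, E z p ↔ (z = a ∨ z = b)

/-- `p` is the Kuratowski ordered pair `⟨a, b⟩`. -/
def OPairE (p a b : M) : Prop :=
  ∃ s t, UPairE E s a a ∧ UPairE E t a b ∧ UPairE E p s t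

/-- The ordered pair `⟨x, y⟩` is an element of `f`. -/
def PairMemE (f x y : M) : Prop := ∃ p, E p f ∧ OPairE E p x y

/-- `f` is (the graph of) a function from `a` to `b`. -/
def IsFuncE (f a b : M) : Prop :=
  (∀ p, E p f → ∃ x y, E x a ∧ E y b ∧ OPairE E p x y) ∧
    ∀ x, E x a → (∃ y, PairMemE E f x y) ∧
      ∀ y y', PairMemE E f x y → PairMemE E f x y' → y = y'

/-- `f` is a surjection from `a` onto `b`. -/
def SurjE (f a b : M) : Prop :=
  IsFuncE E f a b ∧ ∀ y, E y b → ∃ x, E x a ∧ PairMemE E f x y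

/-- `f` is an injection from `a` into `b`. -/
def InjE (f a b : M) : Prop :=
  IsFuncE E f a b ∧ ∀ x x' y, E x a → E x' a →
    PairMemE E f x y → PairMemE E f x' y → x = x'

/-- `f` is a bijection between `a` and `b`. -/
def BijE (f a b : M) : Prop := SurjE E f a b ∧ InjE E f a b

/-- `κ` is a cardinal: an ordinal not in bijection with any of its elements. -/
def CardE (κ : M) : Prop := OrdE E κ ∧ ∀ α, E α κ → ¬ ∃ f, BijE E f α κ

/-- `κ` is an infinite cardinal. -/
def InfCardE (κ : M) : Prop := CardE E κ ∧ InfiniteOrdE E κ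

/-- `b = a ∩ c`. -/
def InterSpecE (b a c : M) : Prop := ∀ z, E z b ↔ (E z a ∧ E z c)

/-- `c` is unbounded in the ordinal `κ`. -/
def UnboundedInE (c κ : M) : Prop := ∀ α, E α κ → ∃ β, E β c ∧ E α β

/-- `c` is closed in the ordinal `κ`: it contains each of its limit points below `κ`. -/
def ClosedInE (c κ : M) : Prop :=
  ∀ l, E l κ → (∃ w, E w l) → (∀ α, E α l → ∃ β, E β c ∧ E α β ∧ E β l) → E l c

/-- `c` is a closed unbounded subset of the ordinal `κ`. -/
def ClubInE (c κ : M) : Prop := SubE E c κ ∧ UnboundedInE E c κ ∧ ClosedInE E c κ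

/-- `f` is (the graph of) a sequence `⟨A_α | α < κ⟩` with `A_α ⊆ α` for all `α < κ`. -/
def SeqSpecE (f κ : M) : Prop :=
  ∀ α, E α κ → (∃ A, PairMemE E f α A ∧ SubE E A α) ∧
    ∀ A A', PairMemE E f α A → PairMemE E f α A' → A = A'

/-- `κ` is a subtle cardinal. -/
def SubtleE (κ : M) : Prop :=
  InfCardE E κ ∧ ∀ f, SeqSpecE E f κ → ∀ c, ClubInE E c κ →
    ∃ α β, E α c ∧ E β c ∧ E α β ∧
      ∃ A B, PairMemE E f α A ∧ PairMemE E f β B ∧ InterSpecE E A B α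

/-- `κ` is a regular ordinal: every function from an element of `κ` to `κ` has
bounded range. -/
def RegularE (κ : M) : Prop :=
  OrdE E κ ∧ ∀ γ f, E γ κ → IsFuncE E f γ κ →
    ∃ β, E β κ ∧ ∀ x y, PairMemE E f x y → E y β

/-- `p = 𝒫(a)`. -/
def PowSpecE (p a : M) : Prop := ∀ z, E z p ↔ SubE E z a

/-- `κ` is a strong limit cardinal: for every `α < κ`, `2^|α| < κ`. -/
def StrongLimitE (κ : M) : Prop :=
  ∀ α, E α κ → ∀ p, PowSpecE E p α → ∃ β f, E β κ ∧ InjE E f p β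

/-- `κ` is a strongly inaccessible cardinal: an uncountable regular strong limit
cardinal. -/
def InaccE (κ : M) : Prop :=
  CardE E κ ∧ (∃ w, OmegaSpecE E w ∧ E w κ) ∧ RegularE E κ ∧ StrongLimitE E κ

/-- `z` belongs to the transitive closure of `x`. -/
def TCMemE (z x : M) : Prop := ∀ t, TransE E t → SubE E x t → E z t

/-- `x ∈ H(θ)`: the transitive closure of `x` has cardinality less than `θ`. -/
def HMemE (x θ : M) : Prop :=
  ∃ t, TransE E t ∧ SubE E x t ∧ ∃ β f, E β θ ∧ SurjE E f β t

/-- `f` is (the graph of) the cumulative-hierarchy sequence `⟨V_β | β < α⟩`,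
determined by the recursion `V_β = {z | ∃ γ < β, z ⊆ V_γ}`. -/
def VHierE (f α : M) : Prop :=
  OrdE E α ∧ ∀ β, E β α →
    (∃ w, PairMemE E f β w ∧
      ∀ z, E z w ↔ ∃ γ, E γ β ∧ ∃ u, PairMemE E f γ u ∧ SubE E z u) ∧
    ∀ w w', PairMemE E f β w → PairMemE E f β w' → w = w'

/-- `x ∈ V_α`. -/
def VMemE (x α : M) : Prop :=
  OrdE E α ∧ ∃ f, VHierE E f α ∧ ∃ β u, E β α ∧ PairMemE E f β u ∧ SubE E x u

/-- The class `S` is a `Σₙ`-elementary subclass of the class `T`. -/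
def SigmaElemPairE (n : ℕ) (S T : M → Prop) : Prop :=
  (∀ x, S x → T x) ∧
    ∀ ⦃k : ℕ⦄ (φ : SetFormula k), IsSigma n φ → ∀ v : Fin k → M, (∀ i, S (v i)) →
      (RealizeIn E S φ v ↔ RealizeIn E T φ v)

/-- The class `S` is a (fully) elementary subclass of the class `T`. -/
def ElemPairE (S T : M → Prop) : Prop :=
  (∀ x, S x → T x) ∧
    ∀ ⦃k : ℕ⦄ (φ : SetFormula k) (v : Fin k → M), (∀ i, S (v i)) →
      (RealizeIn E S φ v ↔ RealizeIn E T φ v)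

/-- `j` is an elementary map from the class `S` into the class `T`. -/
def ElemMapE (S T : M → Prop) (j : M → M) : Prop :=
  (∀ x, S x → T (j x)) ∧
    ∀ ⦃k : ℕ⦄ (φ : SetFormula k) (v : Fin k → M), (∀ i, S (v i)) →
      (RealizeIn E S φ v ↔ RealizeIn E T φ fun i => j (v i))

/-- `α ∈ C⁽ⁿ⁾`: the ordinal `α` is `Σₙ`-correct, i.e. `V_α` is a `Σₙ`-elementary
submodel of the universe. -/
def CnE (n : ℕ) (α : M) : Prop :=
  OrdE E α ∧ SigmaElemPairE E n (fun x => VMemE E x α) fun _ => True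

/-- `κ` is a weakly shrewd cardinal. -/
def WeaklyShrewdE (κ : M) : Prop :=
  CardE E κ ∧ ∀ (φ : SetFormula 2) (θ z : M), CardE E θ → E κ θ → SubE E z κ →
    RealizeIn E (fun x => HMemE E x θ) φ ![z, κ] →
    ∃ κ' θ' z', CardE E κ' ∧ CardE E θ' ∧ E κ' θ' ∧ E κ' κ ∧
      InterSpecE E z' z κ' ∧ RealizeIn E (fun x => HMemE E x θ') φ ![z', κ']

/-- `κ` is a `C⁽ⁿ⁾`-weakly shrewd cardinal. -/
def CnWeaklyShrewdE (n : ℕ) (κ : M) : Prop :=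
  CardE E κ ∧ ∀ (φ : SetFormula 2) (θ z : M), CardE E θ → CnE E n θ → E κ θ →
    SubE E z κ → RealizeIn E (fun x => HMemE E x θ) φ ![z, κ] →
    ∃ κ' θ' z', CardE E κ' ∧ CardE E θ' ∧ CnE E n θ' ∧ E κ' θ' ∧ E κ' κ ∧
      InterSpecE E z' z κ' ∧ RealizeIn E (fun x => HMemE E x θ') φ ![z', κ']

/-- Axiom of extensionality for `(M, E)`. -/
def AxExtE : Prop := ∀ x y : M, (∀ z, E z x ↔ E z y) → x = y

/-- Axiom of pairing for `(M, E)`. -/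
def AxPairE : Prop := ∀ a b : M, ∃ p, UPairE E p a b

/-- Axiom of union for `(M, E)`. -/
def AxUnionE : Prop := ∀ a : M, ∃ u, ∀ z, E z u ↔ ∃ y, E y a ∧ E z y

/-- Axiom of power set for `(M, E)`. -/
def AxPowE : Prop := ∀ a : M, ∃ p, PowSpecE E p a

/-- Axiom of infinity for `(M, E)`. -/
def AxInfE : Prop :=
  ∃ I : M, (∃ e, E e I ∧ EmptyE E e) ∧ ∀ y, E y I → ∃ s, E s I ∧ SuccSpecE E s y

/-- Axiom of foundation for `(M, E)`. -/
def AxFoundE : Prop :=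
  ∀ a : M, (∃ z, E z a) → ∃ m, E m a ∧ ∀ z, E z a → ¬ E z m

/-- Separation scheme for `(M, E)`. -/
def AxSepE : Prop :=
  ∀ (k : ℕ) (φ : SetFormula (k + 1)) (p : Fin k → M) (a : M),
    ∃ s : M, ∀ z, E z s ↔ (E z a ∧ Realize E φ (Fin.cons z p))

/-- Replacement scheme for `(M, E)`. -/
def AxReplE : Prop :=
  ∀ (k : ℕ) (φ : SetFormula (k + 2)) (p : Fin k → M) (a : M),
    (∀ x, E x a → ∀ y y', Realize E φ (Fin.cons x (Fin.cons y p)) →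
      Realize E φ (Fin.cons x (Fin.cons y' p)) → y = y') →
    ∃ b : M, ∀ y, E y b ↔ ∃ x, E x a ∧ Realize E φ (Fin.cons x (Fin.cons y p))

/-- Axiom of choice for `(M, E)`. -/
def AxChoiceE : Prop :=
  ∀ a : M, (∀ x, E x a → ∃ z, E z x) →
    (∀ x y, E x a → E y a → x ≠ y → ¬ ∃ z, E z x ∧ E z y) →
    ∃ c, ∀ x, E x a → ∃ z, E z c ∧ E z x ∧ ∀ z', E z' c → E z' x → z' = z

/-- `(M, E)` is a model of `ZF⁻` (Zermelo–Fraenkel set theory without the power set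
axiom). -/
def IsZFMinusE : Prop :=
  AxExtE E ∧ AxPairE E ∧ AxUnionE E ∧ AxInfE E ∧ AxFoundE E ∧ AxSepE E ∧ AxReplE E

/-- `(M, E)` is a model of `ZFC`. -/
def IsZFCE : Prop :=
  Nonempty M ∧ IsZFMinusE E ∧ AxPowE E ∧ AxChoiceE E

/-- The set `m` is, with the induced membership relation, a transitive model
of `ZF⁻`. -/
def ZFMinusModelE (m : M) : Prop :=
  IsZFMinusE fun a b : {x : M // E x m} => E a.1 b.1

/-- `x` has cardinality `κ`. -/
def CardEqE (x κ : M) : Prop := ∃ f, BijE E f κ x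

/-- `m` is closed under sequences of length less than `κ`: `^{<κ}m ⊆ m`. -/
def SmallSeqClosedE (m κ : M) : Prop := ∀ γ f, E γ κ → IsFuncE E f γ m → E f m

/-- `κ` is a `C⁽ⁿ⁾`-strongly unfoldable cardinal. -/
def CnStronglyUnfoldableE (n : ℕ) (κ : M) : Prop :=
  InaccE E κ ∧ ∀ lam, CnE E n lam → E κ lam →
    ∀ m, TransE E m → ZFMinusModelE E m → CardEqE E m κ → E κ m →
      SmallSeqClosedE E m κ →
      ∃ N j κ', TransE E N ∧ (∀ x, VMemE E x lam → E x N) ∧ IsFuncE E j m N ∧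
        (∀ ⦃k : ℕ⦄ (φ : SetFormula k) (v w : Fin k → M), (∀ i, E (v i) m) →
          (∀ i, PairMemE E j (v i) (w i)) →
          (RealizeIn E (fun x => E x m) φ v ↔ RealizeIn E (fun x => E x N) φ w)) ∧
        (∀ α, E α κ → PairMemE E j α α) ∧ PairMemE E j κ κ' ∧ E lam κ' ∧
        SigmaElemPairE E n (fun x => VMemE E x lam) fun x => E x N ∧ VMemE E x κ'

/-- `x` is ordinal definable. -/
def IsODE (x : M) : Prop :=
  ∃ (k : ℕ) (φ : SetFormula (k + 1)) (p : Fin k → M), (∀ i, OrdE E (p i)) ∧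
    Realize E φ (Fin.cons x p) ∧ ∀ y, Realize E φ (Fin.cons y p) → y = x

/-- `x` is hereditarily ordinal definable, i.e. `x ∈ HOD`. -/
def IsHODE (x : M) : Prop := IsODE E x ∧ ∀ z, TCMemE E z x → IsODE E z

/-- The instance of the principle "`Ord` is essentially faint" for the class
sequence `⟨{A | Efam α A} | α ∈ Ord⟩`. -/
def FaintForE (Efam : M → M → Prop) : Prop :=
  (∀ α, OrdE E α → (∃ A, Efam α A) ∧ ∀ A, Efam α A → SubE E A α) →
    ∀ ξ, OrdE E ξ → ∃ α β A B, OrdE E α ∧ OrdE E β ∧ E ξ α ∧ E α β ∧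
      Efam β A ∧ InterSpecE E B A α ∧ Efam α B

/-- `C` is a closed unbounded class of ordinals. -/
def ClubClassE (C : M → Prop) : Prop :=
  (∀ x, C x → OrdE E x) ∧ (∀ α, OrdE E α → ∃ β, C β ∧ E α β) ∧
    ∀ l, OrdE E l → (∃ w, E w l) → (∀ α, E α l → ∃ β, C β ∧ E α β ∧ E β l) → C l

/-- The instance of the principle "`Ord` is essentially subtle" for the class
sequence `⟨{A | Efam α A} | α ∈ Ord⟩` and the class `C`. -/
def SubtleForE (Efam : M → M → Prop) (C : M → Prop) : Prop :=
  (∀ α, OrdE E α → (∃ A, Efam α A) ∧ ∀ A, Efam α A → SubE E A α) →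
    ClubClassE E C →
    ∃ α β A B, C α ∧ C β ∧ E α β ∧ Efam β A ∧ InterSpecE E B A α ∧ Efam α B

/-- The scheme "`Ord` is essentially faint" holds in `(M, E)`: every instance for a
definable (with parameters) class sequence holds. -/
def OrdFaintDefE : Prop :=
  ∀ (k : ℕ) (φ : SetFormula (k + 2)) (p : Fin k → M),
    FaintForE E fun α A => Realize E φ (Fin.cons α (Fin.cons A p))

/-- The scheme "`Ord` is essentially subtle" holds in `(M, E)`: every instance for
definable (with parameters) class sequences and club classes holds. -/
def OrdSubtleDefE : Prop :=
  ∀ (k k' : ℕ) (φ : SetFormula (k + 2)) (p : Fin k → M)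
    (ψ : SetFormula (k' + 1)) (q : Fin k' → M),
    SubtleForE E (fun α A => Realize E φ (Fin.cons α (Fin.cons A p)))
      fun x => Realize E ψ (Fin.cons x q)

/-- There is a proper class of subtle cardinals in `(M, E)`. -/
def ProperClassSubtleE : Prop := ∀ α, OrdE E α → ∃ κ, SubtleE E κ ∧ E α κ

/-- There are no strongly inaccessible cardinals in `(M, E)`. -/
def NoInaccE : Prop := ∀ κ, ¬ InaccE E κ

end Generic

end Paper
namespace Paper

/-- The membership relation on the universe `ZFSet` of sets. -/
def zmem : ZFSet.{0} → ZFSet.{0} → Prop := fun x y => x ∈ y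

/-- The membership relation on the inner model `HOD` of all hereditarily ordinal
definable sets. -/
def hodMem : {x : ZFSet.{0} // IsHODE zmem x} → {x : ZFSet.{0} // IsHODE zmem x} → Prop :=
  fun a b => a.1 ∈ b.1

/-- `κ` is a subtle cardinal in the inner model `HOD`. -/
def IsSubtleInHOD (κ : ZFSet.{0}) : Prop :=
  ∃ h : IsHODE zmem κ, SubtleE hodMem ⟨κ, h⟩

end Paper

namespace Paper

open Ordinal

/-- Closed unbounded sets of ordinals below `d`. -/
def LClub (C : Set Ordinal.{0}) (d : Ordinal.{0}) : Prop :=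
  (∀ a ∈ C, a < d) ∧ (∀ a < d, ∃ b ∈ C, a < b) ∧
    ∀ l < d, l ≠ 0 → (∀ a < l, ∃ b ∈ C, a < b ∧ b < l) → l ∈ C

/-- Subtlety in terms of ordinals. -/
def LSubtle (d : Ordinal.{0}) : Prop :=
  ∀ (A : Ordinal.{0} → Set Ordinal.{0}) (C : Set Ordinal.{0}),
    (∀ a, ∀ x ∈ A a, x < a) → LClub C d →
    ∃ a ∈ C, ∃ b ∈ C, a < b ∧ ∀ x, x ∈ A a ↔ x ∈ A b ∧ x < a

theorem ordE_iff (x : ZFSet.{0}) : OrdE zmem x ↔ x.IsOrdinal := by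
  rw [ZFSet.isOrdinal_iff_forall_mem_isTransitive]
  constructor
  · rintro ⟨h1, h2⟩
    exact ⟨fun y hy z hz => h1 y hy z hz, fun y hy z hz w hw => h2 y hy z hz w hw⟩
  · rintro ⟨h1, h2⟩
    exact ⟨fun y hy z hz => h1 y hy hz, fun y hy z hz w hw => h2 y hy z hz hw⟩

theorem uPairE_iff (p a b : ZFSet.{0}) : UPairE zmem p a b ↔ p = {a, b} := by
  constructor
  · intro h
    ext z
    rw [ZFSet.mem_pair]
    exact h z
  · rintro rfl z
    exact ZFSet.mem_pair

theorem oPairE_iff (p a b : ZFSet.{0}) : OPairE zmem p a b ↔ p = ZFSet.pair a b := by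
  have e : ({a, a} : ZFSet.{0}) = {a} := by ext; simp
  constructor
  · rintro ⟨s, t, hs, ht, hp⟩
    rw [uPairE_iff] at hs ht hp
    subst hs ht hp
    rw [e]; rfl
  · rintro rfl
    refine ⟨{a, a}, {a, b}, (uPairE_iff _ _ _).2 rfl, (uPairE_iff _ _ _).2 rfl,
      (uPairE_iff _ _ _).2 ?_⟩
    rw [e]; rfl

theorem pairMemE_iff (f x y : ZFSet.{0}) : PairMemE zmem f x y ↔ ZFSet.pair x y ∈ f := by
  constructor
  · rintro ⟨p, hp, h⟩
    rw [oPairE_iff] at h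
    subst h
    exact hp
  · intro h
    exact ⟨_, h, (oPairE_iff _ _ _).2 rfl⟩

theorem mem_T {x : ZFSet.{0}} {o : Ordinal.{0}} :
    zmem x o.toZFSet ↔ ∃ a < o, a.toZFSet = x := mem_toZFSet_iff

theorem T_mem {a b : Ordinal.{0}} : zmem a.toZFSet b.toZFSet ↔ a < b :=
  toZFSet_mem_toZFSet_iff

/-- The graph of a function restricted to a set. -/
noncomputable def graphOn (g : ZFSet.{0} → ZFSet.{0}) (x : ZFSet.{0}) : ZFSet.{0} :=
  letI := @Classical.allZFSetDefinable
  ZFSet.map g x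

theorem mem_graphOn {g : ZFSet.{0} → ZFSet.{0}} {x p : ZFSet.{0}} :
    p ∈ graphOn g x ↔ ∃ z ∈ x, ZFSet.pair z (g z) = p :=
  letI := @Classical.allZFSetDefinable
  ZFSet.mem_map

theorem pair_mem_graphOn {g : ZFSet.{0} → ZFSet.{0}} {x a b : ZFSet.{0}} :
    PairMemE zmem (graphOn g x) a b ↔ a ∈ x ∧ b = g a := by
  rw [pairMemE_iff, mem_graphOn]
  constructor
  · rintro ⟨z, hz, h⟩
    obtain ⟨rfl, rfl⟩ := ZFSet.pair_injective h
    exact ⟨hz, rfl⟩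
  · rintro ⟨h, rfl⟩
    exact ⟨a, h, rfl⟩

theorem lclub_of (d : Ordinal.{0}) (c : ZFSet.{0}) (h : ClubInE zmem c d.toZFSet) :
    LClub {a | a.toZFSet ∈ c} d := by
  obtain ⟨h1, h2, h3⟩ := h
  refine ⟨fun a ha => T_mem.1 (h1 _ ha), ?_, ?_⟩
  · intro a ha
    obtain ⟨b, hb, hab⟩ := h2 _ (T_mem.2 ha)
    obtain ⟨b, hbd, rfl⟩ := mem_T.1 (h1 _ hb)
    exact ⟨b, hb, T_mem.1 hab⟩
  · intro l hl hl0 hlim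
    refine h3 _ (T_mem.2 hl) ⟨Ordinal.toZFSet 0, T_mem.2 (pos_iff_ne_zero.2 hl0)⟩ ?_
    intro a ha
    obtain ⟨a, hal, rfl⟩ := mem_T.1 ha
    obtain ⟨b, hb, hab, hbl⟩ := hlim a hal
    exact ⟨b.toZFSet, hb, T_mem.2 hab, T_mem.2 hbl⟩

theorem club_of_lclub (d : Ordinal.{0}) (C : Set Ordinal.{0}) (h : LClub C d) :
    ClubInE zmem (d.toZFSet.sep fun x => x.rank ∈ C) d.toZFSet := by
  obtain ⟨h1, h2, h3⟩ := h
  refine ⟨fun x hx => (ZFSet.mem_sep.1 hx).1, ?_, ?_⟩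
  · intro a ha
    obtain ⟨a, had, rfl⟩ := mem_T.1 ha
    obtain ⟨b, hb, hab⟩ := h2 a had
    exact ⟨b.toZFSet, ZFSet.mem_sep.2 ⟨T_mem.2 (h1 b hb), by simpa using hb⟩, T_mem.2 hab⟩
  · intro l hl hne hlim
    obtain ⟨l, hld, rfl⟩ := mem_T.1 hl
    refine ZFSet.mem_sep.2 ⟨T_mem.2 hld, ?_⟩
    rw [Ordinal.rank_toZFSet]
    apply h3 l hld
    · rintro rfl
      obtain ⟨w, hw⟩ := hne
      obtain ⟨a, ha, -⟩ := mem_T.1 hw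
      exact absurd ha not_lt_zero
    · intro a ha
      obtain ⟨b, hb, hab, hbl⟩ := hlim _ (T_mem.2 ha)
      obtain ⟨b, hb', rfl⟩ := mem_T.1 hbl
      refine ⟨b, ?_, T_mem.1 hab, hb'⟩
      simpa using (ZFSet.mem_sep.1 hb).2

theorem lsubtle_of (d : Ordinal.{0}) (h : SubtleE zmem d.toZFSet) : LSubtle d := by
  intro A C hA hC
  set g : ZFSet.{0} → ZFSet.{0} := fun x => x.sep fun y => y.rank ∈ A x.rank with hg
  have hseq : SeqSpecE zmem (graphOn g d.toZFSet) d.toZFSet := by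
    intro a ha
    refine ⟨⟨g a, pair_mem_graphOn.2 ⟨ha, rfl⟩, fun z hz => (ZFSet.mem_sep.1 hz).1⟩, ?_⟩
    intro X Y hX hY
    rw [pair_mem_graphOn] at hX hY
    rw [hX.2, hY.2]
  obtain ⟨a, b, ha, hb, hab, X, Y, hX, hY, hXY⟩ :=
    h.2 (graphOn g d.toZFSet) hseq _ (club_of_lclub d C hC)
  · rw [pair_mem_graphOn] at hX hY
    obtain ⟨had, rfl⟩ := hX
    obtain ⟨hbd, rfl⟩ := hY
    obtain ⟨a, had', rfl⟩ := mem_T.1 had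
    obtain ⟨b, hbd', rfl⟩ := mem_T.1 hbd
    have hab' := T_mem.1 hab
    refine ⟨a, by simpa using (ZFSet.mem_sep.1 ha).2, b, by simpa using (ZFSet.mem_sep.1 hb).2,
      hab', fun x => ?_⟩
    have := hXY x.toZFSet
    simp only [hg, zmem, ZFSet.mem_sep, toZFSet_mem_toZFSet_iff, Ordinal.rank_toZFSet] at this
    constructor
    · intro hx
      have := this.1 ⟨hA _ _ hx, hx⟩
      exact ⟨this.1.2, this.2⟩
    · rintro ⟨h1, h2⟩
      exact (this.2 ⟨⟨h2.trans hab', h1⟩, h2⟩).2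

/-- No regressive function is injective on a club of a subtle ordinal. -/
theorem no_regressive {d : Ordinal.{0}} (h : LSubtle d) {C : Set Ordinal.{0}} (hC : LClub C d)
    (g : Ordinal.{0} → Ordinal.{0}) (hg : ∀ a ∈ C, g a < a)
    (hinj : ∀ a ∈ C, ∀ b ∈ C, g a = g b → a = b) : False := by
  obtain ⟨a, ha, b, hb, hab, hx⟩ := h (fun a => {x | x = g a ∧ x < a}) C
    (fun a x hx => hx.2) hC
  have := (hx (g a)).1 ⟨rfl, hg a ha⟩
  exact hab.ne (hinj a ha b hb this.1.1)

theorem club_tail {d e : Ordinal.{0}} (hlim : ∀ a < d, ∃ b < d, a < b) (he : e < d) :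
    LClub {a | e < a ∧ a < d} d := by
  refine ⟨fun a ha => ha.2, ?_, ?_⟩
  · intro a ha
    obtain ⟨b, hb, hab⟩ := hlim _ (max_lt ha he)
    exact ⟨b, ⟨(le_max_right _ _).trans_lt hab, hb⟩, (le_max_left _ _).trans_lt hab⟩
  · intro l hl hl0 hh
    obtain ⟨b, hb, hab, hbl⟩ := hh 0 (pos_iff_ne_zero.2 hl0)
    exact ⟨hb.1.trans hbl, hl⟩

/-- `d` is regular. -/
theorem lregular {d : Ordinal.{0}} (h : LSubtle d) (hlim : ∀ a < d, ∃ b < d, a < b) :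
    ∀ γ < d, ∀ f : Ordinal.{0} → Ordinal.{0}, (∀ i < γ, f i < d) →
      ∃ b < d, ∀ i < γ, f i < b := by
  intro γ
  induction γ using WellFoundedLT.induction with
  | ind γ ih =>
  intro hγ f hf
  by_contra hcon
  push Not at hcon
  let S : Ordinal.{0} → Set Ordinal.{0} := fun i => {b | ∀ j < i, f j < b}
  let H : Ordinal.{0} → Ordinal.{0} := fun i => sInf (S i)
  have hne : ∀ i < γ, ∃ b < d, b ∈ S i := fun i hi =>
    ih i hi (hi.trans hγ) f fun j hj => hf j (hj.trans hi)
  have hH : ∀ i < γ, H i ∈ S i := fun i hi => by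
    obtain ⟨b, -, hb⟩ := hne i hi
    exact csInf_mem ⟨b, hb⟩
  have hle : ∀ i b, b ∈ S i → H i ≤ b := fun i b hb => csInf_le' hb
  have hHd : ∀ i < γ, H i < d := fun i hi => by
    obtain ⟨b, hbd, hb⟩ := hne i hi
    exact (hle i b hb).trans_lt hbd
  have hmono : ∀ i j, i ≤ j → j < γ → H i ≤ H j := fun i j hij hj =>
    hle i _ fun k hk => hH j hj k (hk.trans_le hij)
  have hsucc : ∀ i < γ, Order.succ i < γ := by
    intro i hi
    by_contra hc
    obtain ⟨b, hbd, hb⟩ := hne i hi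
    obtain ⟨b', hb', hbb'⟩ := hlim _ (hf i hi)
    obtain ⟨k, hk, hk'⟩ := hcon (max b b') (max_lt hbd hb')
    have : k ≤ i := Order.lt_succ_iff.1 (hk.trans_le (not_lt.1 hc))
    rcases this.lt_or_eq with h1 | rfl
    · exact absurd (hb k h1) (not_lt.2 ((le_max_left _ _).trans hk'))
    · exact absurd hbb' (not_lt.2 ((le_max_right _ _).trans hk'))
  let C : Set Ordinal.{0} := {a | γ < a ∧ ∃ i < γ, H i = a}
  have hC : LClub C d := by
    refine ⟨?_, ?_, ?_⟩
    · rintro a ⟨-, i, hi, rfl⟩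
      exact hHd i hi
    · intro a ha
      obtain ⟨i, hi, hi'⟩ := hcon _ (max_lt ha hγ)
      have h1 := hH _ (hsucc i hi) i (Order.lt_succ i)
      have h2 := hi'.trans_lt h1
      exact ⟨H (Order.succ i), ⟨(le_max_right _ _).trans_lt h2, _, hsucc i hi, rfl⟩,
        (le_max_left _ _).trans_lt h2⟩
    · intro l hl hl0 hh
      have hγl : γ < l := by
        obtain ⟨b, hb, hab, hbl⟩ := hh 0 (pos_iff_ne_zero.2 hl0)
        exact hb.1.trans hbl
      let P : Set Ordinal.{0} := {i | i < γ ∧ l ≤ H i}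
      have hP : P.Nonempty := by
        obtain ⟨i, hi, hi'⟩ := hcon l hl
        exact ⟨_, hsucc i hi, hi'.trans (hH _ (hsucc i hi) i (Order.lt_succ i)).le⟩
      have hi0 := csInf_mem hP
      set i0 := sInf P with hi0def
      have hmin : ∀ j < i0, H j < l := by
        intro j hj
        by_contra hc
        exact absurd (csInf_le' (s := P) ⟨hj.trans hi0.1, not_lt.1 hc⟩) (not_le.2 hj)
      refine ⟨hγl, i0, hi0.1, le_antisymm (hle _ _ ?_) hi0.2⟩
      intro j hj
      obtain ⟨b, ⟨-, k, hk, rfl⟩, hab, hbl⟩ := hh _ (hmin j hj)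
      have hjk : j < k := by
        by_contra hc
        exact absurd hab (not_lt.2 (hmono k j (not_lt.1 hc) (hj.trans hi0.1)))
      exact (hH k hk j hjk).trans hbl
  have key : ∀ a ∈ C, H (sInf {i | H i = a}) = a := by
    rintro a ⟨-, i, hi, hia⟩
    exact csInf_mem (s := {i | H i = a}) ⟨i, hia⟩
  refine no_regressive h hC (fun a => sInf {i | H i = a}) ?_ ?_
  · rintro a ⟨hγa, i, hi, hia⟩
    exact (csInf_le' (s := {i | H i = a}) hia).trans_lt (hi.trans hγa)
  · intro a ha b hb hab
    rw [← key a ha, ← key b hb]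
    exact congrArg H hab

theorem lomega {d : Ordinal.{0}} (h : LSubtle d) (h0 : 0 < d)
    (hlim : ∀ a < d, ∃ b < d, a < b) : ω < d := by
  by_contra hc
  rw [not_lt] at hc
  have hnat : ∀ a < d, ∃ n : ℕ, a = n := fun a ha => Ordinal.lt_omega0.1 (ha.trans_le hc)
  refine no_regressive h (club_tail hlim h0) (fun a => Ordinal.pred a) ?_ ?_
  · rintro a ⟨ha0, had⟩
    obtain ⟨n, rfl⟩ := hnat a had
    cases n with
    | zero => simp at ha0
    | succ n =>
      have : ((n + 1 : ℕ) : Ordinal.{0}) = Order.succ (n : Ordinal) := by simp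
      rw [this, Ordinal.pred_succ]
      exact Order.lt_succ _
  · rintro a ⟨ha0, had⟩ b ⟨hb0, hbd⟩ hab
    obtain ⟨n, rfl⟩ := hnat a had
    obtain ⟨m, rfl⟩ := hnat b hbd
    cases n with
    | zero => simp at ha0
    | succ n =>
    cases m with
    | zero => simp at hb0
    | succ m =>
      have e1 : ∀ n : ℕ, ((n + 1 : ℕ) : Ordinal.{0}) = Order.succ (n : Ordinal) := by simp
      rw [e1, e1] at hab ⊢
      simp only [Ordinal.pred_succ] at hab
      rw [hab]

theorem lstrong {d : Ordinal.{0}} (h : LSubtle d) (hlim : ∀ a < d, ∃ b < d, a < b) :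
    ∀ x < d, ((2 : Cardinal.{0}) ^ x.card).ord < d := by
  intro x hx
  by_contra hc
  have h1 : d.card ≤ 2 ^ x.card := by
    have := Ordinal.card_le_card (not_lt.1 hc)
    rwa [Cardinal.card_ord] at this
  have h2 : Cardinal.mk (Set.Iio d) ≤ Cardinal.mk (Set (Set.Iio x)) := by
    rw [Cardinal.mk_set, Cardinal.mk_Iio_ordinal, Cardinal.mk_Iio_ordinal]
    have := Cardinal.lift_le.{1}.2 h1
    simpa using this
  obtain ⟨F⟩ := h2
  obtain ⟨a, ha, b, hb, hab, hx'⟩ := h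
    (fun a => {y | ∃ (ha : a < d) (hy : y < x), y < a ∧ (⟨y, hy⟩ : Set.Iio x) ∈ F ⟨a, ha⟩})
    _ (fun a y hy => by obtain ⟨_, _, h, _⟩ := hy; exact h) (club_tail hlim hx)
  have : F ⟨a, ha.2⟩ = F ⟨b, hb.2⟩ := by
    ext ⟨y, hy⟩
    have hy' : y < x := hy
    constructor
    · intro hm
      obtain ⟨⟨_, _, _, h3⟩, _⟩ := (hx' y).1 ⟨ha.2, hy, hy'.trans ha.1, hm⟩
      exact h3
    · intro hm
      obtain ⟨_, _, _, h3⟩ := (hx' y).2 ⟨⟨hb.2, hy, hy'.trans hb.1, hm⟩, hy'.trans ha.1⟩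
      exact h3
  have := F.injective this
  exact hab.ne (congrArg Subtype.val this)

/-- A pairing function on `d`. -/
theorem exists_pairing {d : Ordinal.{0}} (hd : ω < d) :
    ∃ e : Ordinal.{0} → Ordinal.{0} → Ordinal.{0}, (∀ x < d, ∀ y < d, e x y < d) ∧
      ∀ x < d, ∀ y < d, ∀ x' < d, ∀ y' < d, e x y = e x' y' → x = x' ∧ y = y' := by
  have hinf : Cardinal.aleph0 ≤ Cardinal.mk (Set.Iio d) := by
    rw [Cardinal.mk_Iio_ordinal, Cardinal.aleph0_le_lift]
    have := Ordinal.card_le_card hd.le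
    simpa using this
  have : Cardinal.mk (Set.Iio d × Set.Iio d) = Cardinal.mk (Set.Iio d) := by
    rw [← Cardinal.mul_def]
    exact Cardinal.mul_eq_self hinf
  obtain ⟨F⟩ := Cardinal.eq.1 this
  classical
  refine ⟨fun x y => if h : x < d ∧ y < d then (F (⟨x, h.1⟩, ⟨y, h.2⟩)).1 else 0, ?_, ?_⟩
  · intro x hx y hy
    simp only [hx, hy, and_self, dite_true]
    exact (F _).2
  · intro x hx y hy x' hx' y' hy' h
    simp only [hx, hy, hx', hy', and_self, dite_true] at h
    have := F.injective (Subtype.ext h)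
    rw [Prod.mk.injEq] at this
    exact ⟨congrArg Subtype.val this.1, congrArg Subtype.val this.2⟩

theorem club_closure {d : Ordinal.{0}} (hω : ω < d)
    (hlim : ∀ a < d, ∃ b < d, a < b)
    (hreg : ∀ γ < d, ∀ f : Ordinal.{0} → Ordinal.{0}, (∀ i < γ, f i < d) →
      ∃ b < d, ∀ i < γ, f i < b)
    {C : Set Ordinal.{0}} (hC : LClub C d)
    (e : Ordinal.{0} → Ordinal.{0} → Ordinal.{0}) (he : ∀ x < d, ∀ y < d, e x y < d)
    (s : Ordinal.{0} → Ordinal.{0}) (hs : ∀ x < d, s x < d) :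
    LClub {a | a ∈ C ∧ ω < a ∧ ∀ x < a, s x < a ∧ ∀ y < a, e x y < a} d := by
  have step : ∀ x, ∃ y, x < d → y ∈ C ∧ x < y ∧ ω < y ∧
      ∀ z ≤ x, s z < y ∧ ∀ w ≤ x, e z w < y := by
    intro x
    by_cases hx : x < d
    swap
    · exact ⟨0, fun h => absurd h hx⟩
    obtain ⟨x', hx', hxx'⟩ := hlim x hx
    obtain ⟨b1, hb1, hb1'⟩ := hreg x' hx' s fun i hi => hs i (hi.trans hx')
    have : ∀ z, ∃ b, z < d → b < d ∧ ∀ w < x', e z w < b := by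
      intro z
      by_cases hz : z < d
      · obtain ⟨b, hb⟩ := hreg x' hx' (e z) fun i hi => he z hz i (hi.trans hx')
        exact ⟨b, fun _ => hb⟩
      · exact ⟨0, fun h => absurd h hz⟩
    choose B hB using this
    obtain ⟨b2, hb2, hb2'⟩ := hreg x' hx' B fun i hi => (hB i (hi.trans hx')).1
    obtain ⟨y, hyC, hy⟩ := hC.2.1 _ (max_lt (max_lt hx hω) (max_lt hb1 hb2))
    simp only [max_lt_iff] at hy
    refine ⟨y, fun _ => ⟨hyC, hy.1.1, hy.1.2, fun z hz => ?_⟩⟩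
    have hz' := hz.trans_lt hxx'
    refine ⟨(hb1' z hz').trans hy.2.1, fun w hw => ?_⟩
    exact ((hB z (hz'.trans hx')).2 w (hw.trans_lt hxx')).trans ((hb2' z hz').trans hy.2.2)
  choose G hG using step
  refine ⟨fun a ha => hC.1 a ha.1, ?_, ?_⟩
  · intro a ha
    have hit : ∀ n : ℕ, G^[n] a < d := by
      intro n
      induction n with
      | zero => exact ha
      | succ n ih =>
        rw [Function.iterate_succ_apply']
        exact hC.1 _ (hG _ ih).1
    have hsucc : ∀ n : ℕ, G^[n + 1] a = G (G^[n] a) := fun n =>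
      Function.iterate_succ_apply' _ _ _
    let P : Set Ordinal.{0} := {b | ∀ n : ℕ, G^[n] a < b}
    have hP : ∃ b < d, b ∈ P := by
      obtain ⟨b, hb, hb'⟩ := hreg ω hω (fun i => G^[i.card.toNat] a) fun i hi => hit _
      refine ⟨b, hb, fun n => ?_⟩
      have := hb' n (Ordinal.natCast_lt_omega0 n)
      simpa using this
    obtain ⟨b, hbd, hbP⟩ := hP
    have hl := csInf_mem (s := P) ⟨b, hbP⟩
    have hlb : sInf P ≤ b := csInf_le' hbP
    set l := sInf P with hldef
    have hld : l < d := hlb.trans_lt hbd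
    have hbelow : ∀ x < l, ∃ n : ℕ, x ≤ G^[n] a := by
      intro x hx
      by_contra hc
      push Not at hc
      exact absurd (csInf_le' (s := P) hc) (not_le.2 hx)
    have hal : a < l := hl 0
    have hmono : Monotone fun n : ℕ => G^[n] a := by
      apply monotone_nat_of_le_succ
      intro n
      rw [hsucc]
      exact (hG _ (hit n)).2.1.le
    refine ⟨l, ⟨?_, ?_, ?_⟩, hal⟩
    · apply hC.2.2 l hld (pos_iff_ne_zero.1 (bot_le.trans_lt hal))
      intro x hx
      obtain ⟨n, hn⟩ := hbelow x hx
      have := hG _ (hit n)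
      rw [← hsucc] at this
      exact ⟨_, this.1, hn.trans_lt this.2.1, hl _⟩
    · have := (hG _ (hit 0)).2.2.1
      rw [← hsucc] at this
      exact this.trans (hl _)
    · intro x hx
      obtain ⟨n, hn⟩ := hbelow x hx
      refine ⟨?_, fun y hy => ?_⟩
      · have := ((hG _ (hit n)).2.2.2 x hn).1
        rw [← hsucc] at this
        exact this.trans (hl _)
      · obtain ⟨m, hm⟩ := hbelow y hy
        have := ((hG _ (hit (max n m))).2.2.2 x (hn.trans (hmono (le_max_left _ _)))).2 y
          (hm.trans (hmono (le_max_right _ _)))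
        rw [← hsucc] at this
        exact this.trans (hl _)
  · intro l hl hl0 hh
    refine ⟨?_, ?_, ?_⟩
    · apply hC.2.2 l hl hl0
      intro a ha
      obtain ⟨b, hb, h⟩ := hh a ha
      exact ⟨b, hb.1, h⟩
    · obtain ⟨b, hb, h1, h2⟩ := hh 0 (pos_iff_ne_zero.2 hl0)
      exact hb.2.1.trans h2
    · intro x hx
      refine ⟨?_, fun y hy => ?_⟩
      · obtain ⟨b, hb, h1, h2⟩ := hh x hx
        exact (hb.2.2 x h1).1.trans h2
      · obtain ⟨b, hb, h1, h2⟩ := hh _ (max_lt hx hy)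
        exact ((hb.2.2 x ((le_max_left _ _).trans_lt h1)).2 y
          ((le_max_right _ _).trans_lt h1)).trans h2

/-- The main combinatorial lemma. -/
theorem coherence {d : Ordinal.{0}} (h : LSubtle d) {C : Set Ordinal.{0}} (hC : LClub C d)
    (R : Ordinal.{0} → ℕ → Ordinal.{0} → Ordinal.{0} → Prop) :
    ∃ a b, a < b ∧ (∀ c, c = a ∨ c = b → c ∈ C ∧ ω < c ∧
        ∀ x < c, ((2 : Cardinal.{0}) ^ x.card).ord < c) ∧
      ∀ k, ∀ x < a, ∀ y < a, R a k x y ↔ R b k x y := by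
  have hlim : ∀ a < d, ∃ b < d, a < b := fun a ha => by
    obtain ⟨b, hb, hab⟩ := hC.2.1 a ha
    exact ⟨b, hC.1 b hb, hab⟩
  have h0 : 0 < d := by
    obtain ⟨a, ha, -⟩ := h (fun _ => ∅) C (fun a x hx => hx.elim) hC
    exact bot_le.trans_lt (hC.1 a ha)
  have hω := lomega h h0 hlim
  obtain ⟨e, he, hinj⟩ := exists_pairing hω
  have hD := club_closure hω hlim (lregular h hlim) hC e he _ (lstrong h hlim)
  obtain ⟨a, ha, b, hb, hab, hx⟩ := h
    (fun a => {w | w < a ∧ ∃ (k : ℕ) (x y : Ordinal.{0}), x < a ∧ y < a ∧ R a k x y ∧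
      w = e k (e x y)}) _ (fun a x hx => hx.1) hD
  refine ⟨a, b, hab, ?_, ?_⟩
  · rintro c (rfl | rfl)
    · exact ⟨ha.1, ha.2.1, fun x hx => (ha.2.2 x hx).1⟩
    · exact ⟨hb.1, hb.2.1, fun x hx => (hb.2.2 x hx).1⟩
  · intro k x hxa y hya
    have hbd : b < d := hC.1 _ hb.1
    have hka : ∀ k : ℕ, (k : Ordinal.{0}) < a := fun k =>
      (Ordinal.natCast_lt_omega0 k).trans ha.2.1
    have hin : e x y < a := (ha.2.2 x hxa).2 y hya
    have hout : e k (e x y) < a := (ha.2.2 _ (hka k)).2 _ hin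
    have had := hab.trans hbd
    have dec : ∀ (k' : ℕ) (x' y' : Ordinal.{0}), x' < d → y' < d →
        e k (e x y) = e k' (e x' y') → k = k' ∧ x = x' ∧ y = y' := by
      intro k' x' y' hx' hy' heq
      have h1 := hinj _ ((hka k).trans had) _ (hin.trans had) _ ((hka k').trans had) _
        (he _ hx' _ hy') heq
      refine ⟨by exact_mod_cast h1.1, hinj _ (hxa.trans had) _ (hya.trans had) _ hx' _ hy' h1.2⟩
    constructor
    · intro hR
      obtain ⟨⟨-, k', x', y', hx', hy', hRR, heq⟩, -⟩ :=
        (hx (e k (e x y))).1 ⟨hout, k, x, y, hxa, hya, hR, rfl⟩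
      obtain ⟨rfl, rfl, rfl⟩ := dec k' x' y' (hx'.trans hbd) (hy'.trans hbd) heq
      exact hRR
    · intro hR
      obtain ⟨-, k', x', y', hx', hy', hRR, heq⟩ :=
        (hx (e k (e x y))).2 ⟨⟨hout.trans hab, k, x, y, hxa.trans hab, hya.trans hab, hR, rfl⟩,
          hout⟩
      obtain ⟨rfl, rfl, rfl⟩ := dec k' x' y' (hx'.trans had) (hy'.trans had) heq
      exact hRR

/-- Coding formulas by natural numbers. -/
def fcode : {n : ℕ} → SetFormula n → ℕ
  | _, .mem i j => 5 * Nat.pair i j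
  | _, .eq i j => 5 * Nat.pair i j + 1
  | _, .fal => 2
  | _, .imp φ ψ => 5 * Nat.pair (fcode φ) (fcode ψ) + 3
  | _, .all φ => 5 * fcode φ + 4

theorem fcode_inj {n : ℕ} (φ ψ : SetFormula n) (h : fcode φ = fcode ψ) : φ = ψ := by
  induction φ with
  | mem i j =>
    cases ψ <;> simp only [fcode] at h <;> try omega
    have := Nat.pair_eq_pair.1 (Nat.eq_of_mul_eq_mul_left (by norm_num : 0 < 5)
      (by first | exact h | exact Nat.add_right_cancel h))
    rw [Fin.ext this.1, Fin.ext this.2]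
  | eq i j =>
    cases ψ <;> simp only [fcode] at h <;> try omega
    have := Nat.pair_eq_pair.1 (Nat.eq_of_mul_eq_mul_left (by norm_num : 0 < 5)
      (by first | exact h | exact Nat.add_right_cancel h))
    rw [Fin.ext this.1, Fin.ext this.2]
  | fal =>
    cases ψ <;> simp only [fcode] at h <;> try omega
    rfl
  | imp φ1 φ2 ih1 ih2 =>
    cases ψ <;> simp only [fcode] at h <;> try omega
    have := Nat.pair_eq_pair.1 (Nat.eq_of_mul_eq_mul_left (by norm_num : 0 < 5)
      (by first | exact h | exact Nat.add_right_cancel h))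
    rw [ih1 _ this.1, ih2 _ this.2]
  | all φ ih =>
    cases ψ <;> simp only [fcode] at h <;> try omega
    rw [ih _ (Nat.eq_of_mul_eq_mul_left (by norm_num : 0 < 5) (Nat.add_right_cancel h))]

theorem cardE_of {a : Ordinal.{0}}
    (hs : ∀ x < a, ((2 : Cardinal.{0}) ^ x.card).ord < a) : CardE zmem a.toZFSet := by
  refine ⟨(ordE_iff _).2 (ZFSet.isOrdinal_toZFSet a), ?_⟩
  rintro x hx ⟨f, hf⟩
  obtain ⟨x, hxa, rfl⟩ := mem_T.1 hx
  have h1 : x.card < a.card := by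
    have := Ordinal.card_le_card (hs x hxa).le
    rw [Cardinal.card_ord] at this
    exact (Cardinal.cantor _).trans_le this
  have hsurj := hf.1.2
  have hfun := hf.1.1
  have : ∀ y : Set.Iio a, ∃ z : Set.Iio x, PairMemE zmem f z.1.toZFSet y.1.toZFSet := by
    rintro ⟨y, hy⟩
    obtain ⟨z, hz, hp⟩ := hsurj _ (T_mem.2 hy)
    obtain ⟨z, hzx, rfl⟩ := mem_T.1 hz
    exact ⟨⟨z, hzx⟩, hp⟩
  choose g hg using this
  have hginj : Function.Injective g := by
    intro y y' hyy
    have h2 := hg y'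
    rw [← hyy] at h2
    have := (hfun.2 _ (T_mem.2 (g y).2)).2 _ _ (hg y) h2
    exact Subtype.ext (toZFSet_injective this)
  have := Cardinal.mk_le_of_injective hginj
  rw [Cardinal.mk_Iio_ordinal, Cardinal.mk_Iio_ordinal, Cardinal.lift_le] at this
  exact absurd h1 (not_lt.2 this)

theorem strongLimitE_of {a : Ordinal.{0}}
    (hs : ∀ x < a, ((2 : Cardinal.{0}) ^ x.card).ord < a) : StrongLimitE zmem a.toZFSet := by
  intro x hx p hp
  obtain ⟨x, hxa, rfl⟩ := mem_T.1 hx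
  set b := ((2 : Cardinal.{0}) ^ x.card).ord with hb
  have h2 : Cardinal.mk (Set (Set.Iio x)) ≤ Cardinal.mk (Set.Iio b) := by
    rw [Cardinal.mk_set, Cardinal.mk_Iio_ordinal, Cardinal.mk_Iio_ordinal, hb, Cardinal.card_ord]
    simp
  obtain ⟨F⟩ := h2
  let g : ZFSet.{0} → ZFSet.{0} := fun z => (F {y | y.1.toZFSet ∈ z}).1.toZFSet
  refine ⟨b.toZFSet, graphOn g p, T_mem.2 (hs x hxa), ⟨?_, ?_⟩, ?_⟩
  · intro q hq
    obtain ⟨z, hz, rfl⟩ := mem_graphOn.1 hq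
    exact ⟨z, g z, hz, T_mem.2 (F _).2, (oPairE_iff _ _ _).2 rfl⟩
  · intro z hz
    refine ⟨⟨g z, pair_mem_graphOn.2 ⟨hz, rfl⟩⟩, ?_⟩
    intro y y' hy hy'
    rw [(pair_mem_graphOn.1 hy).2, (pair_mem_graphOn.1 hy').2]
  · intro z z' y hz hz' hy hy'
    have e1 := (pair_mem_graphOn.1 hy).2
    have e2 := (pair_mem_graphOn.1 hy').2
    have := F.injective (Subtype.ext (toZFSet_injective (e1.symm.trans e2)))
    have sub : ∀ u v : ZFSet.{0}, zmem u p →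
        ({y | y.1.toZFSet ∈ u} : Set (Set.Iio x)) = {y | y.1.toZFSet ∈ v} → ∀ w ∈ u, w ∈ v := by
      intro u v hu heq w hw
      obtain ⟨w, hwx, rfl⟩ := mem_T.1 ((hp u).1 hu w hw)
      have : (⟨w, hwx⟩ : Set.Iio x) ∈ ({y | y.1.toZFSet ∈ u} : Set (Set.Iio x)) := hw
      rw [heq] at this
      exact this
    ext w
    exact ⟨sub z z' hz this w, sub z' z hz' this.symm w⟩

theorem omegaSpec : OmegaSpecE zmem (Ordinal.toZFSet ω) := by
  refine ⟨⟨(ordE_iff _).2 (ZFSet.isOrdinal_toZFSet _), ⟨Ordinal.toZFSet 0,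
    T_mem.2 omega0_pos⟩, ?_⟩, ?_⟩
  · intro a ha
    obtain ⟨a, haω, rfl⟩ := mem_T.1 ha
    obtain ⟨n, rfl⟩ := Ordinal.lt_omega0.1 haω
    exact ⟨Ordinal.toZFSet (n + 1 : ℕ), T_mem.2 (Ordinal.natCast_lt_omega0 _),
      T_mem.2 (by exact_mod_cast Nat.lt_succ_self n)⟩
  · intro a ha hl
    obtain ⟨a, haω, rfl⟩ := mem_T.1 ha
    obtain ⟨n, rfl⟩ := Ordinal.lt_omega0.1 haω
    obtain ⟨-, ⟨w, hw⟩, hlim⟩ := hl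
    cases n with
    | zero =>
      obtain ⟨w, hw', -⟩ := mem_T.1 hw
      simp at hw'
    | succ n =>
      obtain ⟨b, hb, hnb⟩ := hlim (Ordinal.toZFSet (n : ℕ))
        (T_mem.2 (by exact_mod_cast Nat.lt_succ_self n))
      obtain ⟨b, hb', rfl⟩ := mem_T.1 hb
      have h1 := T_mem.1 hnb
      obtain ⟨m, rfl⟩ := Ordinal.lt_omega0.1 (hb'.trans haω)
      have h2 : m < n + 1 := by exact_mod_cast hb'
      have h3 : n < m := by exact_mod_cast h1
      omega

/-- `f` is a witness to `κ` not being regular, with domain `γ`. -/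
def NonReg (κ γ f : ZFSet.{0}) : Prop :=
  zmem γ κ ∧ IsFuncE zmem f γ κ ∧ ∀ β, zmem β κ → ∃ x y, PairMemE zmem f x y ∧ ¬ zmem y β

/-- `φ, θ, z` witness that `κ` is not shrewd. -/
def NonShrewd (n : ℕ) (κ : ZFSet.{0}) (φ : SetFormula 2) (θ z : ZFSet.{0}) : Prop :=
  CardE zmem θ ∧ CnE zmem n θ ∧ zmem κ θ ∧ SubE zmem z κ ∧
    RealizeIn zmem (fun x => HMemE zmem x θ) φ ![z, κ] ∧
    ¬ ∃ κ' θ' z', CardE zmem κ' ∧ CardE zmem θ' ∧ CnE zmem n θ' ∧ zmem κ' θ' ∧ zmem κ' κ ∧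
      InterSpecE zmem z' z κ' ∧ RealizeIn zmem (fun x => HMemE zmem x θ') φ ![z', κ']

theorem main_ord (n : ℕ) (d : Ordinal.{0}) (h : LSubtle d) (C : Set Ordinal.{0})
    (hC : LClub C d) : ∃ a ∈ C, InaccE zmem a.toZFSet ∧ CnWeaklyShrewdE zmem n a.toZFSet := by
  by_contra hcon
  push Not at hcon
  have w1 : ∀ a : Ordinal.{0}, ∃ γ f, (∃ γ f, NonReg a.toZFSet γ f) → NonReg a.toZFSet γ f := by
    intro a
    by_cases hx : ∃ γ f, NonReg a.toZFSet γ f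
    · obtain ⟨γ, f, hf⟩ := hx
      exact ⟨γ, f, fun _ => hf⟩
    · exact ⟨∅, ∅, fun h => absurd h hx⟩
  have w2 : ∀ a : Ordinal.{0}, ∃ φ θ z, (∃ φ θ z, NonShrewd n a.toZFSet φ θ z) →
      NonShrewd n a.toZFSet φ θ z := by
    intro a
    by_cases hx : ∃ φ θ z, NonShrewd n a.toZFSet φ θ z
    · obtain ⟨φ, θ, z, hf⟩ := hx
      exact ⟨φ, θ, z, fun _ => hf⟩
    · exact ⟨.fal, ∅, ∅, fun h => absurd h hx⟩
  choose Γ F hF using w1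
  choose Φ Θ Z hZ using w2
  obtain ⟨a, b, hab, hgood, hcoh⟩ := coherence h hC fun a k x y =>
    (k = 0 ∧ ∃ γ f, NonReg a.toZFSet γ f) ∨ (k = 1 ∧ x.toZFSet = Γ a) ∨
    (k = 2 ∧ PairMemE zmem (F a) x.toZFSet y.toZFSet) ∨
    (k = 3 ∧ x = (fcode (Φ a) : ℕ)) ∨ (k = 4 ∧ x.toZFSet ∈ Z a)
  have hga := hgood a (Or.inl rfl)
  have hgb := hgood b (Or.inr rfl)
  have ha0 : 0 < a := omega0_pos.trans hga.2.1
  have c0 := hcoh 0 0 ha0 0 ha0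
  have c1 := fun x hx => hcoh 1 x hx 0 ha0
  have c2 := hcoh 2
  have c3 := fun x hx => hcoh 3 x hx 0 ha0
  have c4 := fun x hx => hcoh 4 x hx 0 ha0
  simp at c0 c1 c2 c3 c4
  by_cases hreg : ∃ γ f, NonReg a.toZFSet γ f
  · have hA := hF a hreg
    have hB := hF b (c0.1 hreg)
    obtain ⟨hγ, hfun, -⟩ := hA
    obtain ⟨γ, hγa, hγe⟩ := mem_T.1 hγ
    have hγb := (c1 γ hγa).1 hγe
    obtain ⟨x, y, hxy, hy⟩ := hB.2.2 a.toZFSet (T_mem.2 hab)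
    obtain ⟨p, hp, hp'⟩ := hxy
    obtain ⟨x', y', hx', hy', hpp⟩ := hB.2.1.1 p hp
    rw [oPairE_iff] at hp' hpp
    obtain ⟨rfl, rfl⟩ := ZFSet.pair_injective (hp'.symm.trans hpp)
    rw [← hγb] at hx'
    obtain ⟨x, hxγ, rfl⟩ := mem_T.1 hx'
    have hx'' := hx'
    rw [hγe] at hx''
    obtain ⟨u, q, hq, hq'⟩ := (hfun.2 _ hx'').1
    obtain ⟨v, u', hv, hu', hqq⟩ := hfun.1 q hq
    rw [oPairE_iff] at hq' hqq
    obtain ⟨rfl, rfl⟩ := ZFSet.pair_injective (hq'.symm.trans hqq)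
    obtain ⟨u, hua, rfl⟩ := mem_T.1 hu'
    have hFa : PairMemE zmem (F a) x.toZFSet u.toZFSet := ⟨q, hq, (oPairE_iff _ _ _).2 hq'⟩
    have hFb := (c2 x (hxγ.trans hγa) u hua).1 hFa
    have hFb' : PairMemE zmem (F b) x.toZFSet y := ⟨p, hp, (oPairE_iff _ _ _).2 hp'⟩
    have hB2 := hB.2.1.2
    rw [← hγb] at hB2
    have := (hB2 _ hx').2 _ _ hFb hFb'
    subst this
    exact hy (T_mem.2 hua)
  · have hregb : ¬ ∃ γ f, NonReg b.toZFSet γ f := fun hh => hreg (c0.2 hh)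
    have inacc : ∀ c : Ordinal.{0}, ω < c → (∀ x < c, ((2 : Cardinal.{0}) ^ x.card).ord < c) →
        (¬ ∃ γ f, NonReg c.toZFSet γ f) → InaccE zmem c.toZFSet := by
      intro c hω hs hr
      refine ⟨cardE_of hs, ⟨_, omegaSpec, T_mem.2 hω⟩,
        ⟨(ordE_iff _).2 (ZFSet.isOrdinal_toZFSet c), ?_⟩, strongLimitE_of hs⟩
      intro γ f hγ hf
      by_contra hc
      refine hr ⟨γ, f, hγ, hf, fun β hβ => ?_⟩
      by_contra hc2
      push Not at hc2
      exact hc ⟨β, hβ, hc2⟩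
    have shrewd : ∀ c : Ordinal.{0}, InaccE zmem c.toZFSet →
        ¬ CnWeaklyShrewdE zmem n c.toZFSet → ∃ φ θ z, NonShrewd n c.toZFSet φ θ z := by
      intro c hi hns
      by_contra hc
      refine hns ⟨hi.1, fun φ θ z h1 h2 h3 h4 h5 => ?_⟩
      by_contra hc2
      exact hc ⟨φ, θ, z, h1, h2, h3, h4, h5, hc2⟩
    have ia := inacc a hga.2.1 hga.2.2 hreg
    have ib := inacc b hgb.2.1 hgb.2.2 hregb
    obtain ⟨a1, a2, a3, a4, a5, -⟩ := hZ a (shrewd a ia (hcon a hga.1 ia))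
    obtain ⟨b1, b2, b3, b4, b5, b6⟩ := hZ b (shrewd b ib (hcon b hgb.1 ib))
    have hφ : Φ a = Φ b := by
      have := (c3 (fcode (Φ a) : ℕ) ((Ordinal.natCast_lt_omega0 _).trans hga.2.1))
      apply fcode_inj
      simpa using this
    refine b6 ⟨a.toZFSet, Θ a, Z a, ia.1, a1, a2, a3, T_mem.2 hab, ?_, hφ ▸ a5⟩
    intro w
    constructor
    · intro hw
      obtain ⟨w, hwa, rfl⟩ := mem_T.1 (a4 w hw)
      exact ⟨(c4 w hwa).1 hw, T_mem.2 hwa⟩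
    · rintro ⟨hw, hwa⟩
      obtain ⟨w, hwa', rfl⟩ := mem_T.1 hwa
      exact (c4 w hwa').2 hw

end Paper

namespace Paper

/-- **Lemma 3.4.** Given a natural number `n > 0`, every subtle cardinal is a
stationary limit of strongly inaccessible `C⁽ⁿ⁾`-weakly shrewd cardinals: for every
subtle cardinal `δ`, the set of strongly inaccessible `C⁽ⁿ⁾`-weakly shrewd cardinals
below `δ` intersects every closed unbounded subset of `δ`. -/
theorem subtle_is_stationary_limit_of_inaccessible_shrewd (n : ℕ) (hn : 0 < n)
    (δ : ZFSet.{0}) (hδ : SubtleE zmem δ) :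
    ∀ c : ZFSet.{0}, ClubInE zmem c δ →
      ∃ κ : ZFSet.{0}, κ ∈ c ∧ InaccE zmem κ ∧ CnWeaklyShrewdE zmem n κ := by
  intro c hc
  have hord : δ.IsOrdinal := (ordE_iff δ).1 hδ.1.1.1
  rw [← ZFSet.IsOrdinal.toZFSet_rank_eq hord] at hδ hc
  obtain ⟨a, ha, h1, h2⟩ := main_ord n _ (lsubtle_of _ hδ) _ (lclub_of _ _ hc)
  exact ⟨_, ha, h1, h2⟩

end Paper
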